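/- Let K satisfy Assumption A, let T > 0, and let f be a mass-conserving weak solution of the coagulation equation on [0,T] with kernel K and initial datum f_in. Let x₁, x₂ ∈ (0,∞) with x₁ < x₂ and η₀ ∈ (0, min(1, x₁)) be such that x₂ − x₁ ≥ 3η₀ and f_in(B(x₁, η)) > 0 and f_in(B(x₂, η)) > 0 for every 0 < η ≤ η₀. Then for every n ∈ ℕ and every t ∈ [0,T] there exists a constant C₁(t,x₁,η₀,n) > 0 with ∫_{B(x₁, η₀/2ⁿ)} f(dv,t) ≥ C₁(t,x₁,η₀,n), and for every t ∈ (0,T] there exists a constant C₂(t,x₁,x₂,η₀,n) > 0 with ∫_{B(x₁+x₂, η₀/2ⁿ)} f(dv,t) ≥ C₂(t,x₁,x₂,η₀,n). -/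

import Mathlib

open MeasureTheory Set Filter

noncomputable section

/-- Assumption A on the coagulation kernel `K(v,v') = h(v,v') g(v/(v+v'))`. -/
structure KernelAssumptionA (K : ℝ → ℝ → ℝ) (h : ℝ → ℝ → ℝ) (g : ℝ → ℝ)
    (γ H H₀ H₁ G₀ G₁ k : ℝ) : Prop where
  K_nonneg : ∀ v v', 0 ≤ v → 0 ≤ v' → 0 ≤ K v v'
  K_eq : ∀ v v', 0 ≤ v → 0 ≤ v' → 0 < v + v' →
      K v v' = h v v' * g (v / (v + v'))
  h_cont : ContinuousOn (fun p : ℝ × ℝ => h p.1 p.2) (Ici 0 ×ˢ Ici 0)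
  h_symm : ∀ v v', h v v' = h v' v
  γ_gt_one : 1 < γ
  H_gt_one : 1 < H
  H₀_pos : 0 < H₀
  h_lower : ∀ v v', 0 ≤ v → 0 ≤ v' → H < v + v' →
      H₀ * (v ^ γ + v' ^ γ) ≤ h v v'
  h_posOn : ∀ R : ℝ, 0 < R → ∃ C : ℝ, 0 < C ∧
      ∀ v ∈ Icc (1 / R) R, ∀ v' ∈ Icc (1 / R) R, C ≤ h v v'
  H₁_pos : 0 < H₁
  h_upper : ∀ v v', 0 ≤ v → 0 ≤ v' → h v v' ≤ H₁ * (v ^ γ + v' ^ γ)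
  g_cont : ContinuousOn g (Icc 0 1)
  g_symm : ∀ x ∈ Icc (0 : ℝ) 1, g x = g (1 - x)
  g_half : g (1 / 2) = 0
  G₀_pos : 0 < G₀
  G₁_pos : 0 < G₁
  k_ge_one : 1 ≤ k
  g_lower : ∀ x ∈ Icc (0 : ℝ) 1, G₀ * |x - 1 / 2| ^ k ≤ g x
  g_upper : ∀ x ∈ Icc (0 : ℝ) 1, g x ≤ G₁

/-- Weak solution of the coagulation equation on `[0, T]` with kernel `K`
and initial datum `fin`, in the sense of measures on `(0,∞)`. -/
structure IsWeakSolution (K : ℝ → ℝ → ℝ) (γ T : ℝ)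
    (f : ℝ → Measure ℝ) (fin : Measure ℝ) : Prop where
  conc : ∀ t ∈ Icc (0 : ℝ) T, f t (Iic 0) = 0
  time_cont : ∀ φ : ℝ → ℝ, Continuous φ → (∃ M : ℝ, ∀ v, |φ v| ≤ M) →
      ContinuousOn (fun t => ∫ v, φ v ∂(f t)) (Icc (0 : ℝ) T)
  moment_bound : ∃ C : ℝ, ∀ t ∈ Icc (0 : ℝ) T,
      Integrable (fun v => 1 + v ^ γ) (f t) ∧ (∫ v, (1 + v ^ γ) ∂(f t)) ≤ C
  weak_form : ∀ φ : ℝ → ℝ, Continuous φ → HasCompactSupport φ →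
      tsupport φ ⊆ Ioi 0 → ∀ t ∈ Icc (0 : ℝ) T,
      (∫ v, φ v ∂(f t)) - (∫ v, φ v ∂fin) =
        (1 / 2) * ∫ s in (0 : ℝ)..t,
          (∫ v, (∫ v', K v v' * (φ (v + v') - φ v - φ v') ∂(f s)) ∂(f s))

/-- The solution conserves mass on `[0, T]`. -/
def IsMassConserving (T : ℝ) (f : ℝ → Measure ℝ) (fin : Measure ℝ) : Prop :=
  Integrable (fun v => v) fin ∧
    ∀ t ∈ Icc (0 : ℝ) T,
      Integrable (fun v => v) (f t) ∧ (∫ v, v ∂(f t)) = ∫ v, v ∂fin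

/-- `μ` is a single Dirac measure `M • δ_V` with `M, V ∈ (0,∞)`. -/
def IsSingleDirac (μ : Measure ℝ) : Prop :=
  ∃ M V : ℝ, 0 < M ∧ 0 < V ∧ μ = ENNReal.ofReal M • Measure.dirac V

lemma aux_gronwall (F b : ℝ → ℝ) (T c F0 : ℝ)
    (hF : ContinuousOn F (Icc 0 T)) (hb : IntervalIntegrable b volume 0 T)
    (hFb : ∀ t ∈ Icc 0 T, F t - F0 = (1 / 2) * ∫ s in (0 : ℝ)..t, b s)
    (hlow : ∀ s ∈ Icc 0 T, -(2 * c * F s) ≤ b s) (hF0 : ∀ s ∈ Icc 0 T, 0 ≤ F s)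
    (hc : 0 ≤ c) (t₀ : ℝ) (ht₀ : t₀ ∈ Icc 0 T) (hz : F t₀ = 0) :
    ∀ s ∈ Icc 0 t₀, F s = 0 := by
  have hT : (0 : ℝ) ≤ T := ht₀.1.trans ht₀.2
  obtain ⟨E, hE, hEF⟩ : ∃ E : ℝ → ℝ, Continuous E ∧ ∀ s ∈ Icc 0 T, E s = F s := by
    refine ⟨IccExtend hT ((Icc 0 T).domRestrict F), ?_, ?_⟩
    · exact (continuousOn_iff_continuous_domRestrict.mp hF).Icc_extend'
    · intro s hs
      rw [IccExtend_of_mem _ _ hs]; rfl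
  have hsub : ∀ s ∈ Icc 0 t₀, s ∈ Icc 0 T := fun s hs => ⟨hs.1, hs.2.trans ht₀.2⟩
  have key : ∀ s ∈ Icc 0 t₀, F s ≤ c * ∫ u in s..t₀, E u := by
    intro s hs
    have h0T : uIcc (0:ℝ) T = Icc 0 T := uIcc_of_le hT
    have i1 : IntervalIntegrable b volume 0 s := hb.mono_set (by
      rw [h0T, uIcc_of_le hs.1]; exact Icc_subset_Icc le_rfl (hsub s hs).2)
    have i2 : IntervalIntegrable b volume s t₀ := hb.mono_set (by
      rw [h0T, uIcc_of_le hs.2]; exact Icc_subset_Icc hs.1 ht₀.2)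
    have e1 := hFb s (hsub s hs)
    have e2 := hFb t₀ ht₀
    have e3 := intervalIntegral.integral_add_adjacent_intervals i1 i2
    have e4 : ∫ u in s..t₀, -(2 * c * E u) ≤ ∫ u in s..t₀, b u := by
      apply intervalIntegral.integral_mono_on hs.2 _ i2
      · intro u hu
        have hu' : u ∈ Icc 0 T := ⟨hs.1.trans hu.1, hu.2.trans ht₀.2⟩
        rw [hEF u hu']; exact hlow u hu'
      · exact (by fun_prop : Continuous fun u => -(2 * c * E u)).intervalIntegrable _ _
    rw [intervalIntegral.integral_neg, intervalIntegral.integral_const_mul] at e4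
    linarith
  let G : ℝ → ℝ := fun s => Real.exp (c * s) * ∫ u in s..t₀, E u
  have hG : ∀ s, HasDerivAt G (Real.exp (c * s) * c * (∫ u in s..t₀, E u)
      + Real.exp (c * s) * (- E s)) s := by
    intro s
    have h1 : HasDerivAt (fun s => Real.exp (c * s)) (Real.exp (c * s) * c) s := by
      have := ((hasDerivAt_id s).const_mul c).exp
      simpa using this
    have h2 : HasDerivAt (fun s => ∫ u in s..t₀, E u) (- E s) s :=
      intervalIntegral.integral_hasDerivAt_left (hE.intervalIntegrable _ _)
        (hE.stronglyMeasurableAtFilter _ _) hE.continuousAt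
    exact h1.mul h2
  have hmono : MonotoneOn G (Icc 0 t₀) := by
    apply monotoneOn_of_deriv_nonneg (convex_Icc _ _)
    · exact fun s _ => (hG s).continuousAt.continuousWithinAt
    · exact fun s _ => (hG s).differentiableAt.differentiableWithinAt
    · intro s hs
      have hs' := interior_subset hs
      rw [(hG s).deriv]
      have h1 := key s hs'
      have h2 := hEF s (hsub s hs')
      have h3 := Real.exp_pos (c * s)
      have : Real.exp (c * s) * c * (∫ u in s..t₀, E u) + Real.exp (c * s) * (- E s)
        = Real.exp (c * s) * (c * (∫ u in s..t₀, E u) - E s) := by ring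
      rw [this]
      exact mul_nonneg h3.le (by linarith)
  intro s hs
  have h1 : G s ≤ G t₀ := hmono hs ⟨ht₀.1, le_rfl⟩ hs.2
  have h2 : G t₀ = 0 := by simp [G]
  have h3 : ∫ u in s..t₀, E u ≤ 0 := by
    by_contra hcon
    push Not at hcon
    have : 0 < G s := mul_pos (Real.exp_pos _) hcon
    linarith
  have h4 := key s hs
  have h5 := hF0 s (hsub s hs)
  have h6 := mul_nonneg hc (neg_nonneg.mpr h3)
  linarith

/-- The kernel truncated to the open quadrant. -/
def auxKt (K : ℝ → ℝ → ℝ) : ℝ × ℝ → ℝ :=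
  indicator (Ioi 0 ×ˢ Ioi 0) (fun p => K p.1 p.2)

section aux
variable {K h : ℝ → ℝ → ℝ} {g : ℝ → ℝ} {γ H H₀ H₁ G₀ G₁ k : ℝ}

lemma auxKt_meas (hK : KernelAssumptionA K h g γ H H₀ H₁ G₀ G₁ k) : Measurable (auxKt K) := by
  have hm : MeasurableSet (Ioi (0:ℝ) ×ˢ Ioi (0:ℝ)) := measurableSet_Ioi.prod measurableSet_Ioi
  have hc : ContinuousOn (fun p : ℝ × ℝ => K p.1 p.2) (Ioi 0 ×ˢ Ioi 0) := by
    have : ContinuousOn (fun p : ℝ × ℝ => h p.1 p.2 * g (p.1 / (p.1 + p.2)))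
        (Ioi 0 ×ˢ Ioi 0) := by
      apply ContinuousOn.mul
      · exact hK.h_cont.mono (prod_mono Ioi_subset_Ici_self Ioi_subset_Ici_self)
      · refine hK.g_cont.comp (ContinuousOn.div (by fun_prop) (by fun_prop) ?_) ?_
        · rintro ⟨a, b⟩ ⟨ha, hb⟩
          simp only [mem_Ioi] at ha hb
          dsimp; positivity
        · rintro ⟨a, b⟩ ⟨ha, hb⟩
          simp only [mem_Ioi] at ha hb
          refine ⟨by dsimp; positivity, ?_⟩
          dsimp
          rw [div_le_one (by positivity)]; linarith
    refine this.congr ?_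
    rintro ⟨a, b⟩ ⟨ha, hb⟩
    simp only [mem_Ioi] at ha hb
    exact hK.K_eq a b ha.le hb.le (by positivity)
  unfold auxKt
  classical
  rw [← Set.piecewise_eq_indicator]
  exact hc.measurable_piecewise continuousOn_const hm

lemma auxKt_nonneg (hK : KernelAssumptionA K h g γ H H₀ H₁ G₀ G₁ k) (p : ℝ × ℝ) :
    0 ≤ auxKt K p := by
  apply indicator_nonneg
  rintro ⟨a, b⟩ ⟨ha, hb⟩
  exact hK.K_nonneg a b (le_of_lt ha) (le_of_lt hb)

lemma auxK_le (hK : KernelAssumptionA K h g γ H H₀ H₁ G₀ G₁ k) {a b : ℝ} (ha : 0 < a)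
    (hb : 0 < b) : K a b ≤ H₁ * G₁ * (a ^ γ + b ^ γ) := by
  rw [hK.K_eq a b ha.le hb.le (by positivity)]
  have hx : a / (a + b) ∈ Icc (0:ℝ) 1 :=
    ⟨by positivity, by rw [div_le_one (by positivity)]; linarith⟩
  have g0 : 0 ≤ g (a / (a + b)) :=
    le_trans (mul_nonneg hK.G₀_pos.le (by positivity)) (hK.g_lower _ hx)
  have g1 := hK.g_upper _ hx
  have h1 := hK.h_upper a b ha.le hb.le
  have := hK.H₁_pos
  calc h a b * g (a / (a + b)) ≤ (H₁ * (a ^ γ + b ^ γ)) * g (a / (a + b)) := by gcongr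
    _ ≤ (H₁ * (a ^ γ + b ^ γ)) * G₁ := by gcongr
    _ = _ := by ring

lemma auxK_pos (hK : KernelAssumptionA K h g γ H H₀ H₁ G₀ G₁ k) {a b : ℝ} (ha : 0 < a)
    (hab : a < b) : 0 < K a b := by
  have hb := ha.trans hab
  rw [hK.K_eq a b ha.le hb.le (by positivity)]
  have hx : a / (a + b) ∈ Icc (0:ℝ) 1 :=
    ⟨by positivity, by rw [div_le_one (by positivity)]; linarith⟩
  have hne : a / (a + b) - 1 / 2 ≠ 0 := by
    intro hcon
    field_simp at hcon
    linarith
  have g0 : 0 < g (a / (a + b)) := by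
    refine lt_of_lt_of_le (mul_pos hK.G₀_pos ?_) (hK.g_lower _ hx)
    exact Real.rpow_pos_of_pos (abs_pos.mpr hne) _
  obtain ⟨C, hC, hCh⟩ := hK.h_posOn (max b (1 / a)) (by positivity)
  have hmem : ∀ v, a ≤ v → v ≤ b → v ∈ Icc (1 / max b (1 / a)) (max b (1 / a)) := by
    intro v h1 h2
    refine ⟨le_trans ?_ h1, le_trans h2 (le_max_left _ _)⟩
    rw [div_le_iff₀ (by positivity)]
    have := mul_le_mul_of_nonneg_left (le_max_right b (1 / a)) ha.le
    rwa [mul_one_div_cancel ha.ne'] at this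
  exact mul_pos (lt_of_lt_of_le hC (hCh a (hmem a le_rfl hab.le) b (hmem b hab.le le_rfl))) g0

lemma auxKt_bound (hK : KernelAssumptionA K h g γ H H₀ H₁ G₀ G₁ k) (p : ℝ × ℝ) :
    auxKt K p ≤ H₁ * G₁ * (|1 + p.1 ^ γ| * |1 + p.2 ^ γ|) := by
  have hA : 0 ≤ H₁ * G₁ := mul_nonneg hK.H₁_pos.le hK.G₁_pos.le
  unfold auxKt
  by_cases hp : p ∈ Ioi (0:ℝ) ×ˢ Ioi (0:ℝ)
  · rw [indicator_of_mem hp]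
    obtain ⟨h1, h2⟩ := hp
    simp only [mem_Ioi] at h1 h2
    refine (auxK_le hK h1 h2).trans ?_
    have e1 : 0 ≤ p.1 ^ γ := by positivity
    have e2 : 0 ≤ p.2 ^ γ := by positivity
    rw [abs_of_nonneg (by positivity), abs_of_nonneg (by positivity)]
    apply mul_le_mul_of_nonneg_left _ hA
    nlinarith [mul_nonneg e1 e2]
  · rw [indicator_of_notMem hp]; positivity

lemma aux_finite {μ : Measure ℝ} (h0 : μ (Iic 0) = 0)
    (hi : Integrable (fun v => 1 + v ^ γ) μ) :
    IsFiniteMeasure μ ∧ (∀ᵐ v ∂μ, 0 < v) ∧ μ univ ≤ ENNReal.ofReal (∫ v, (1 + v ^ γ) ∂μ) := by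
  have hpos : ∀ᵐ v ∂μ, 0 < v := by
    rw [ae_iff]; simpa [Iic] using h0
  have h1 : μ univ ≤ ENNReal.ofReal (∫ v, (1 + v ^ γ) ∂μ) := by
    rw [ofReal_integral_eq_lintegral_ofReal hi]
    · calc μ univ = ∫⁻ _, 1 ∂μ := by simp
        _ ≤ _ := by
          apply lintegral_mono_ae
          filter_upwards [hpos] with v hv
          have : 0 ≤ v ^ γ := by positivity
          rw [← ENNReal.ofReal_one]
          exact ENNReal.ofReal_le_ofReal (by linarith)
    · filter_upwards [hpos] with v hv
      have : 0 ≤ v ^ γ := by positivity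
      simp only [Pi.zero_apply]; linarith
  exact ⟨⟨h1.trans_lt ENNReal.ofReal_lt_top⟩, hpos, h1⟩

/-- The kernel integrand. -/
def auxPhi (K : ℝ → ℝ → ℝ) (φ : ℝ → ℝ) (p : ℝ × ℝ) : ℝ :=
  auxKt K p * (φ (p.1 + p.2) - φ p.1 - φ p.2)

lemma aux_integrable (hK : KernelAssumptionA K h g γ H H₀ H₁ G₀ G₁ k) {μ : Measure ℝ}
    [IsFiniteMeasure μ] (hi : Integrable (fun v => 1 + v ^ γ) μ)
    {ψ : ℝ × ℝ → ℝ} (hψ : Continuous ψ) {M : ℝ} (hM : ∀ p, |ψ p| ≤ M) :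
    Integrable (fun p => auxKt K p * ψ p) (μ.prod μ) := by
  have hW := (hi.abs.mul_prod hi.abs).const_mul (H₁ * G₁ * M)
  refine hW.mono ((auxKt_meas hK).mul hψ.measurable).aestronglyMeasurable ?_
  refine Eventually.of_forall fun p => ?_
  have hA : 0 ≤ H₁ * G₁ := mul_nonneg hK.H₁_pos.le hK.G₁_pos.le
  have hM0 : 0 ≤ M := (abs_nonneg _).trans (hM p)
  rw [Real.norm_eq_abs, Real.norm_eq_abs, abs_mul, abs_of_nonneg (auxKt_nonneg hK p)]
  refine le_trans ?_ (le_abs_self _)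
  calc auxKt K p * |ψ p| ≤ (H₁ * G₁ * (|1 + p.1 ^ γ| * |1 + p.2 ^ γ|)) * M :=
        mul_le_mul (auxKt_bound hK p) (hM p) (abs_nonneg _) (by positivity)
    _ = _ := by ring

lemma aux_iter (hK : KernelAssumptionA K h g γ H H₀ H₁ G₀ G₁ k) {μ : Measure ℝ}
    [IsFiniteMeasure μ] (hi : Integrable (fun v => 1 + v ^ γ) μ) (hpos : ∀ᵐ v ∂μ, 0 < v)
    {φ : ℝ → ℝ} (hφ : Continuous φ) {M : ℝ} (hM : ∀ p, |φ p| ≤ M) :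
    (∫ v, (∫ v', K v v' * (φ (v + v') - φ v - φ v') ∂μ) ∂μ)
      = ∫ p, auxPhi K φ p ∂(μ.prod μ) := by
  have hint : Integrable (auxPhi K φ) (μ.prod μ) := by
    refine aux_integrable hK hi (ψ := fun p => φ (p.1 + p.2) - φ p.1 - φ p.2)
      (by fun_prop) (M := M + M + M) ?_
    intro p
    have h1 := abs_le.mp (hM (p.1 + p.2))
    have h2 := abs_le.mp (hM p.1)
    have h3 := abs_le.mp (hM p.2)
    rw [abs_le]; constructor <;> linarith [h1.1, h1.2, h2.1, h2.2, h3.1, h3.2]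
  rw [integral_prod _ hint]
  apply integral_congr_ae
  filter_upwards [hpos] with v hv
  apply integral_congr_ae
  filter_upwards [hpos] with w hw
  have : (v, w) ∈ Ioi (0:ℝ) ×ˢ Ioi (0:ℝ) := ⟨hv, hw⟩
  simp only [auxPhi, auxKt]
  rw [indicator_of_mem this]

lemma aux_lower (hK : KernelAssumptionA K h g γ H H₀ H₁ G₀ G₁ k) {μ : Measure ℝ}
    [IsFiniteMeasure μ] (hi : Integrable (fun v => 1 + v ^ γ) μ) (hpos : ∀ᵐ v ∂μ, 0 < v)
    {C : ℝ} (hC : (∫ v, (1 + v ^ γ) ∂μ) ≤ C)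
    {φ : ℝ → ℝ} (hφ : Continuous φ) (hφ0 : ∀ v, 0 ≤ φ v) {M : ℝ} (hM : ∀ p, |φ p| ≤ M)
    {R : ℝ} (hR0 : 0 ≤ R) (hR : ∀ v, R < v → φ v = 0) :
    (∫ p, auxKt K p * φ (p.1 + p.2) ∂(μ.prod μ))
      - 2 * (H₁ * G₁ * (R ^ γ + 1) * C) * (∫ v, φ v ∂μ) ≤ ∫ p, auxPhi K φ p ∂(μ.prod μ) := by
  have hA : 0 ≤ H₁ * G₁ := mul_nonneg hK.H₁_pos.le hK.G₁_pos.le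
  have hγ : 0 ≤ γ := by linarith [hK.γ_gt_one]
  have hRγ : 0 ≤ R ^ γ := by positivity
  have i0 : Integrable (fun p => auxKt K p * φ (p.1 + p.2)) (μ.prod μ) :=
    aux_integrable hK hi (ψ := fun p => φ (p.1 + p.2)) (by fun_prop) fun p => hM _
  have i1 : Integrable (fun p => auxKt K p * φ p.1) (μ.prod μ) :=
    aux_integrable hK hi (ψ := fun p => φ p.1) (by fun_prop) fun p => hM _
  have i2 : Integrable (fun p => auxKt K p * φ p.2) (μ.prod μ) :=
    aux_integrable hK hi (ψ := fun p => φ p.2) (by fun_prop) fun p => hM _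
  have iφ : Integrable φ μ :=
    Integrable.of_bound hφ.aestronglyMeasurable M (Eventually.of_forall hM)
  have hF0 : 0 ≤ ∫ v, φ v ∂μ := integral_nonneg hφ0
  have habs : ∫ v, |1 + v ^ γ| ∂μ ≤ C := by
    refine le_trans (le_of_eq (integral_congr_ae ?_)) hC
    filter_upwards [hpos] with v hv
    exact abs_of_nonneg (by positivity)
  have pw : ∀ a b : ℝ, 0 < a → 0 < b → a ≤ R →
      a ^ γ + b ^ γ ≤ (R ^ γ + 1) * |1 + b ^ γ| := by
    intro a b ha hb hab
    have h1 : a ^ γ ≤ R ^ γ := Real.rpow_le_rpow ha.le hab hγ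
    have h2 : 0 ≤ b ^ γ := by positivity
    rw [abs_of_nonneg (by positivity)]
    nlinarith [mul_nonneg hRγ h2]
  have b1 : ∫ p, auxKt K p * φ p.1 ∂(μ.prod μ) ≤ (H₁ * G₁ * (R ^ γ + 1) * C) * (∫ v, φ v ∂μ) := by
    calc ∫ p, auxKt K p * φ p.1 ∂(μ.prod μ)
        ≤ ∫ p, (H₁ * G₁ * (R ^ γ + 1)) * (φ p.1 * |1 + p.2 ^ γ|) ∂(μ.prod μ) := by
          apply integral_mono i1 ((iφ.mul_prod hi.abs).const_mul _)
          intro p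
          dsimp only
          by_cases hp : p ∈ Ioi (0:ℝ) ×ˢ Ioi (0:ℝ)
          · rw [auxKt, indicator_of_mem hp]
            obtain ⟨h1, h2⟩ := hp
            simp only [mem_Ioi] at h1 h2
            by_cases hpR : p.1 ≤ R
            · have := mul_le_mul_of_nonneg_right ((auxK_le hK h1 h2).trans
                (mul_le_mul_of_nonneg_left (pw _ _ h1 h2 hpR) hA)) (hφ0 p.1)
              refine this.trans (le_of_eq (by ring))
            · rw [hR _ (not_le.mp hpR)]; simp
          · rw [auxKt, indicator_of_notMem hp]
            have := hφ0 p.1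
            rw [zero_mul]; positivity
      _ = (H₁ * G₁ * (R ^ γ + 1)) * ((∫ v, φ v ∂μ) * ∫ v, |1 + v ^ γ| ∂μ) := by
          rw [integral_const_mul, integral_prod_mul (fun v => φ v) (fun v => |1 + v ^ γ|)]
      _ ≤ (H₁ * G₁ * (R ^ γ + 1)) * ((∫ v, φ v ∂μ) * C) := by gcongr
      _ = _ := by ring
  have b2 : ∫ p, auxKt K p * φ p.2 ∂(μ.prod μ) ≤ (H₁ * G₁ * (R ^ γ + 1) * C) * (∫ v, φ v ∂μ) := by
    calc ∫ p, auxKt K p * φ p.2 ∂(μ.prod μ)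
        ≤ ∫ p, (H₁ * G₁ * (R ^ γ + 1)) * (|1 + p.1 ^ γ| * φ p.2) ∂(μ.prod μ) := by
          apply integral_mono i2 ((hi.abs.mul_prod iφ).const_mul _)
          intro p
          dsimp only
          by_cases hp : p ∈ Ioi (0:ℝ) ×ˢ Ioi (0:ℝ)
          · rw [auxKt, indicator_of_mem hp]
            obtain ⟨h1, h2⟩ := hp
            simp only [mem_Ioi] at h1 h2
            by_cases hpR : p.2 ≤ R
            · have := pw _ _ h2 h1 hpR
              rw [add_comm] at this
              have := mul_le_mul_of_nonneg_right ((auxK_le hK h1 h2).trans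
                (mul_le_mul_of_nonneg_left this hA)) (hφ0 p.2)
              refine this.trans (le_of_eq (by ring))
            · rw [hR _ (not_le.mp hpR)]; simp
          · rw [auxKt, indicator_of_notMem hp]
            have := hφ0 p.2
            rw [zero_mul]; positivity
      _ = (H₁ * G₁ * (R ^ γ + 1)) * ((∫ v, |1 + v ^ γ| ∂μ) * (∫ v, φ v ∂μ)) := by
          rw [integral_const_mul, integral_prod_mul (fun v => |1 + v ^ γ|) (fun v => φ v)]
      _ ≤ (H₁ * G₁ * (R ^ γ + 1)) * (C * (∫ v, φ v ∂μ)) := by gcongr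
      _ = _ := by ring
  have hsplit : ∫ p, auxPhi K φ p ∂(μ.prod μ) = (∫ p, auxKt K p * φ (p.1 + p.2) ∂(μ.prod μ))
      - (∫ p, auxKt K p * φ p.1 ∂(μ.prod μ)) - ∫ p, auxKt K p * φ p.2 ∂(μ.prod μ) := by
    rw [← integral_sub i0 i1, ← integral_sub (f := fun p : ℝ × ℝ => auxKt K p * φ (p.1 + p.2) - auxKt K p * φ p.1)
      (i0.sub i1) i2]
    apply integral_congr_ae
    refine Eventually.of_forall fun p => ?_
    simp only [auxPhi]; ring
  rw [hsplit]; linarith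

lemma aux_upper (hK : KernelAssumptionA K h g γ H H₀ H₁ G₀ G₁ k) {μ : Measure ℝ}
    [IsFiniteMeasure μ] (hi : Integrable (fun v => 1 + v ^ γ) μ) (hpos : ∀ᵐ v ∂μ, 0 < v)
    {C : ℝ} (hC : (∫ v, (1 + v ^ γ) ∂μ) ≤ C)
    {φ : ℝ → ℝ} {M : ℝ} (hM : ∀ p, |φ p| ≤ M) :
    |∫ p, auxPhi K φ p ∂(μ.prod μ)| ≤ H₁ * G₁ * (3 * M) * (C * C) := by
  have hA : 0 ≤ H₁ * G₁ := mul_nonneg hK.H₁_pos.le hK.G₁_pos.le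
  have hM0 : 0 ≤ M := (abs_nonneg _).trans (hM 0)
  have habs : ∫ v, |1 + v ^ γ| ∂μ ≤ C := by
    refine le_trans (le_of_eq (integral_congr_ae ?_)) hC
    filter_upwards [hpos] with v hv
    exact abs_of_nonneg (by positivity)
  have hC0 : 0 ≤ ∫ v, |1 + v ^ γ| ∂μ := integral_nonneg fun _ => abs_nonneg _
  have := norm_integral_le_of_norm_le (f := auxPhi K φ)
    ((hi.abs.mul_prod hi.abs).const_mul (H₁ * G₁ * (3 * M))) (Eventually.of_forall fun p => by
      unfold auxPhi
      rw [Real.norm_eq_abs, abs_mul, abs_of_nonneg (auxKt_nonneg hK p)]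
      have h1 := abs_le.mp (hM (p.1 + p.2))
      have h2 := abs_le.mp (hM p.1)
      have h3 := abs_le.mp (hM p.2)
      have h4 : |φ (p.1 + p.2) - φ p.1 - φ p.2| ≤ 3 * M := by
        rw [abs_le]; constructor <;> linarith [h1.1, h1.2, h2.1, h2.2, h3.1, h3.2]
      calc _ ≤ (H₁ * G₁ * (|1 + p.1 ^ γ| * |1 + p.2 ^ γ|)) * (3 * M) :=
            mul_le_mul (auxKt_bound hK p) h4 (abs_nonneg _) (by positivity)
        _ = _ := by ring)
  rw [Real.norm_eq_abs] at this
  refine this.trans ?_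
  rw [integral_const_mul, integral_prod_mul (fun v => |1 + v ^ γ|) (fun v => |1 + v ^ γ|)]
  have hC1 : 0 ≤ C := hC0.trans habs
  gcongr

open Classical in
/-- The solution extended by zero in time. -/
def auxExt (T : ℝ) (f : ℝ → Measure ℝ) (s : ℝ) : Measure ℝ :=
  if s ∈ Icc (0 : ℝ) T then f s else 0

lemma aux_ext_meas {T : ℝ} {f : ℝ → Measure ℝ} {fin : Measure ℝ}
    (hf : IsWeakSolution K γ T f fin) (hfm : ∀ s, IsFiniteMeasure (auxExt T f s)) :
    Measurable (auxExt T f) := by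
  have hcl : ∀ S : Set ℝ, IsClosed S → Measurable fun s => auxExt T f s S := by
    intro S hS
    refine measurable_of_tendsto_metrizable
      (f := fun n s => ∫⁻ x, hS.apprSeq n x ∂(auxExt T f s)) ?_ ?_
    · intro n
      have hc : Continuous fun x => ((hS.apprSeq n x : NNReal) : ℝ) :=
        NNReal.continuous_coe.comp (hS.apprSeq n).continuous
      have hb : ∀ x, |((hS.apprSeq n x : NNReal) : ℝ)| ≤ 1 := by
        intro x
        rw [abs_of_nonneg (NNReal.coe_nonneg _)]
        exact_mod_cast HasOuterApproxClosed.apprSeq_apply_le_one hS n x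
      have h1 := hf.time_cont _ hc ⟨1, hb⟩
      have h2 : (fun s => ∫⁻ x, hS.apprSeq n x ∂(auxExt T f s)) = fun s => ENNReal.ofReal
          ((Icc (0:ℝ) T).indicator
            (fun t => ∫ v, ((hS.apprSeq n v : NNReal) : ℝ) ∂(f t)) s) := by
        funext s
        by_cases hs : s ∈ Icc (0:ℝ) T
        · have e : auxExt T f s = f s := by simp [auxExt, hs]
          rw [indicator_of_mem hs, e]
          have := hfm s
          rw [e] at this
          rw [ofReal_integral_eq_lintegral_ofReal]
          · simp
          · exact Integrable.of_bound hc.aestronglyMeasurable 1 (Eventually.of_forall hb)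
          · exact Eventually.of_forall fun x => NNReal.coe_nonneg _
        · have e : auxExt T f s = 0 := by simp only [auxExt, if_neg hs]
          rw [indicator_of_notMem hs, e]; simp
      rw [h2]
      apply ENNReal.measurable_ofReal.comp
      classical
      rw [← Set.piecewise_eq_indicator]
      exact h1.measurable_piecewise continuousOn_const measurableSet_Icc
    · rw [tendsto_pi_nhds]
      intro s
      exact HasOuterApproxClosed.tendsto_lintegral_apprSeq hS _
  refine Measurable.measure_of_isPiSystem
    ((BorelSpace.measurable_eq (α := ℝ)).trans (borel_eq_generateFrom_Iic ℝ))
    isPiSystem_Iic ?_ (hcl _ isClosed_univ)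
  rintro _ ⟨a, rfl⟩
  exact hcl _ isClosed_Iic

lemma aux_intervalIntegrable (hK : KernelAssumptionA K h g γ H H₀ H₁ G₀ G₁ k)
    {T : ℝ} (hT : 0 < T) {f : ℝ → Measure ℝ} {fin : Measure ℝ}
    (hf : IsWeakSolution K γ T f fin)
    {φ : ℝ → ℝ} (hφ : Continuous φ) {M : ℝ} (hM : ∀ p, |φ p| ≤ M) :
    IntervalIntegrable (fun s => ∫ p, auxPhi K φ p ∂((f s).prod (f s))) volume 0 T := by
  obtain ⟨C, hC⟩ := hf.moment_bound
  have hfin : ∀ s ∈ Icc (0:ℝ) T, f s univ ≤ ENNReal.ofReal C := fun s hs =>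
    ((aux_finite (hf.conc s hs) (hC s hs).1).2.2).trans (ENNReal.ofReal_le_ofReal (hC s hs).2)
  have hbd : ∀ s, auxExt T f s univ ≤ ENNReal.ofReal C := by
    intro s
    by_cases hs : s ∈ Icc (0:ℝ) T
    · simpa only [auxExt, if_pos hs] using hfin s hs
    · simp only [auxExt, if_neg hs]; simp
  have hfm : ∀ s, IsFiniteMeasure (auxExt T f s) := fun s =>
    ⟨(hbd s).trans_lt ENNReal.ofReal_lt_top⟩
  let κ : ProbabilityTheory.Kernel ℝ ℝ := ⟨auxExt T f, aux_ext_meas hf hfm⟩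
  have hκ : ProbabilityTheory.IsFiniteKernel κ :=
    ⟨⟨ENNReal.ofReal C, ENNReal.ofReal_lt_top, hbd⟩⟩
  have hPhi : StronglyMeasurable (auxPhi K φ) := by
    apply Measurable.stronglyMeasurable
    exact (auxKt_meas hK).mul (by fun_prop)
  have hmeas : StronglyMeasurable fun s => ∫ p, auxPhi K φ p
      ∂((ProbabilityTheory.Kernel.prod κ κ) s) := hPhi.integral_kernel
  rw [intervalIntegrable_iff_integrableOn_Ioc_of_le hT.le]
  refine Integrable.of_bound (C := H₁ * G₁ * (3 * M) * (C * C)) ?_ ?_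
  · refine hmeas.aestronglyMeasurable.congr ?_
    filter_upwards [ae_restrict_mem measurableSet_Ioc] with s hs
    rw [ProbabilityTheory.Kernel.prod_apply]
    have : κ s = f s := if_pos (Ioc_subset_Icc_self hs)
    rw [this]
  · filter_upwards [ae_restrict_mem measurableSet_Ioc] with s hs
    have hs' := Ioc_subset_Icc_self hs
    obtain ⟨h1, h2, -⟩ := aux_finite (hf.conc s hs') (hC s hs').1
    obtain ⟨hmoment, hbound⟩ := hC s hs'
    exact aux_upper hK hmoment h2 hbound hM

/-- Tent function. -/
def auxTent (x r v : ℝ) : ℝ := max 0 (r - |v - x|)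

lemma auxTent_cont (x r : ℝ) : Continuous (auxTent x r) := by
  unfold auxTent; fun_prop

lemma auxTent_nonneg (x r v : ℝ) : 0 ≤ auxTent x r v := le_max_left _ _

lemma auxTent_le {x r : ℝ} (hr : 0 ≤ r) (v : ℝ) : |auxTent x r v| ≤ r := by
  rw [abs_of_nonneg (auxTent_nonneg _ _ _)]
  exact max_le hr (by linarith [abs_nonneg (v - x)])

lemma auxTent_support (x r : ℝ) : Function.support (auxTent x r) = Metric.ball x r := by
  ext v
  simp only [Function.mem_support, Metric.mem_ball, Real.dist_eq, auxTent]
  constructor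
  · intro hv
    by_contra hcon
    exact hv (max_eq_left (by linarith))
  · intro hv
    rw [max_eq_right (by linarith)]
    linarith

lemma auxTent_int_pos {x r : ℝ} (hr : 0 ≤ r) (μ : Measure ℝ) [IsFiniteMeasure μ] :
    0 < ∫ v, auxTent x r v ∂μ ↔ 0 < μ (Metric.ball x r) := by
  rw [integral_pos_iff_support_of_nonneg (fun v => auxTent_nonneg x r v), auxTent_support]
  exact Integrable.of_bound (auxTent_cont x r).aestronglyMeasurable r
    (Eventually.of_forall fun v => auxTent_le hr v)

lemma aux_package (hK : KernelAssumptionA K h g γ H H₀ H₁ G₀ G₁ k)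
    {T : ℝ} (hT : 0 < T) {f : ℝ → Measure ℝ} {fin : Measure ℝ}
    (hf : IsWeakSolution K γ T f fin) {x r : ℝ} (hr : 0 < r) (hrx : r < x) :
    ∃ c b, 0 ≤ c ∧ IntervalIntegrable b volume 0 T ∧
      (∀ t ∈ Icc 0 T, (∫ v, auxTent x r v ∂(f t)) - (∫ v, auxTent x r v ∂fin)
        = (1 / 2) * ∫ s in (0 : ℝ)..t, b s) ∧
      (∀ s ∈ Icc 0 T, (∫ p, auxKt K p * auxTent x r (p.1 + p.2) ∂((f s).prod (f s)))
        - 2 * c * (∫ v, auxTent x r v ∂(f s)) ≤ b s) := by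
  obtain ⟨C, hC⟩ := hf.moment_bound
  have hA : 0 ≤ H₁ * G₁ := mul_nonneg hK.H₁_pos.le hK.G₁_pos.le
  have h0T : (0:ℝ) ∈ Icc 0 T := ⟨le_rfl, hT.le⟩
  have hC0 : 0 ≤ C := by
    refine le_trans (integral_nonneg_of_ae ?_) (hC 0 h0T).2
    filter_upwards [(aux_finite (hf.conc 0 h0T) (hC 0 h0T).1).2.1] with v hv
    have : 0 ≤ v ^ γ := by positivity
    simp only [Pi.zero_apply]; linarith
  have hx : 0 < x := hr.trans hrx
  have hts : tsupport (auxTent x r) ⊆ Metric.closedBall x r := by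
    rw [tsupport, auxTent_support]; exact Metric.closure_ball_subset_closedBall
  refine ⟨H₁ * G₁ * ((x + r) ^ γ + 1) * C,
    fun s => ∫ p, auxPhi K (auxTent x r) p ∂((f s).prod (f s)), by positivity,
    aux_intervalIntegrable hK hT hf (auxTent_cont x r) (auxTent_le hr.le), ?_, ?_⟩
  · intro t ht
    rw [hf.weak_form (auxTent x r) (auxTent_cont x r)
      ((isCompact_closedBall x r).of_isClosed_subset (isClosed_tsupport _) hts) ?_ t ht]
    · congr 1
      apply intervalIntegral.integral_congr
      intro s hs
      rw [uIcc_of_le ht.1] at hs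
      have hs' : s ∈ Icc 0 T := ⟨hs.1, hs.2.trans ht.2⟩
      obtain ⟨h1, h2, -⟩ := aux_finite (hf.conc s hs') (hC s hs').1
      exact aux_iter hK (hC s hs').1 h2 (auxTent_cont x r) (auxTent_le hr.le)
    · intro v hv
      have := hts hv
      rw [Metric.mem_closedBall, Real.dist_eq, abs_le] at this
      simp only [mem_Ioi]; linarith [this.1]
  · intro s hs
    obtain ⟨h1, h2, -⟩ := aux_finite (hf.conc s hs) (hC s hs).1
    refine aux_lower hK (hC s hs).1 h2 (hC s hs).2 (auxTent_cont x r)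
      (auxTent_nonneg x r) (auxTent_le hr.le) (by positivity) ?_
    intro v hv
    rw [auxTent, max_eq_left]
    have := le_abs_self (v - x)
    linarith

lemma aux_zero (hK : KernelAssumptionA K h g γ H H₀ H₁ G₀ G₁ k)
    {T : ℝ} (hT : 0 < T) {f : ℝ → Measure ℝ} {fin : Measure ℝ}
    (hf : IsWeakSolution K γ T f fin) {x r : ℝ} (hr : 0 < r) (hrx : r < x)
    {t₀ : ℝ} (ht₀ : t₀ ∈ Icc 0 T) (hz : (∫ v, auxTent x r v ∂(f t₀)) = 0) :
    ∀ s ∈ Icc 0 t₀, (∫ v, auxTent x r v ∂(f s)) = 0 := by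
  obtain ⟨c, b, hc, hb, h1, h2⟩ := aux_package hK hT hf hr hrx
  refine aux_gronwall (fun t => ∫ v, auxTent x r v ∂(f t)) b T c _
    (hf.time_cont _ (auxTent_cont x r) ⟨r, auxTent_le hr.le⟩) hb h1 ?_
    (fun s _ => integral_nonneg (auxTent_nonneg x r)) hc t₀ ht₀ hz
  intro s hs
  have h3 : 0 ≤ ∫ p, auxKt K p * auxTent x r (p.1 + p.2) ∂((f s).prod (f s)) :=
    integral_nonneg fun p => mul_nonneg (auxKt_nonneg hK p) (auxTent_nonneg _ _ _)
  linarith [h2 s hs]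

lemma aux_ball_pos (hK : KernelAssumptionA K h g γ H H₀ H₁ G₀ G₁ k)
    {T : ℝ} (hT : 0 < T) {f : ℝ → Measure ℝ} {fin : Measure ℝ} [IsFiniteMeasure fin]
    (hf : IsWeakSolution K γ T f fin) {x r : ℝ} (hr : 0 < r) (hrx : r < x)
    (hpos : 0 < fin (Metric.ball x r)) {t : ℝ} (ht : t ∈ Icc 0 T) :
    0 < f t (Metric.ball x r) := by
  obtain ⟨C, hC⟩ := hf.moment_bound
  obtain ⟨hfin, -, -⟩ := aux_finite (hf.conc t ht) (hC t ht).1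
  rw [← auxTent_int_pos hr.le]
  refine lt_of_le_of_ne (integral_nonneg (auxTent_nonneg x r)) fun hz => ?_
  have h0 := aux_zero hK hT hf hr hrx ht hz.symm 0 ⟨le_rfl, ht.1⟩
  obtain ⟨c, b, hc, hb, h1, h2⟩ := aux_package hK hT hf hr hrx
  have h3 := h1 0 ⟨le_rfl, hT.le⟩
  rw [intervalIntegral.integral_same, h0] at h3
  have := (auxTent_int_pos (x := x) hr.le fin).2 hpos
  linarith

lemma aux_sum_pos (hK : KernelAssumptionA K h g γ H H₀ H₁ G₀ G₁ k)
    {T : ℝ} (hT : 0 < T) {f : ℝ → Measure ℝ} {fin : Measure ℝ} [IsFiniteMeasure fin]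
    (hf : IsWeakSolution K γ T f fin) {x y r : ℝ} (hr : 0 < r) (hrx : r < x)
    (hxy : x + r < y)
    (hpos : 0 < fin (Metric.ball x (r / 2))) (hpos' : 0 < fin (Metric.ball y (r / 2)))
    {t : ℝ} (ht : t ∈ Ioc 0 T) :
    0 < f t (Metric.ball (x + y) r) := by
  have ht' := Ioc_subset_Icc_self ht
  obtain ⟨C, hC⟩ := hf.moment_bound
  obtain ⟨hfin, -, -⟩ := aux_finite (hf.conc t ht') (hC t ht').1
  have hrxy : r < x + y := by linarith
  rw [← auxTent_int_pos hr.le]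
  refine lt_of_le_of_ne (integral_nonneg (auxTent_nonneg _ r)) fun hz => ?_
  have h0 := aux_zero hK hT hf hr hrxy ht' hz.symm
  obtain ⟨c, b, hc, hb, h1, h2⟩ := aux_package hK hT hf hr hrxy
  have hbpos : 0 < ∫ s in (0:ℝ)..t, b s := by
    refine intervalIntegral.intervalIntegral_pos_of_pos_on (hb.mono_set ?_) ?_ ht.1
    · rw [uIcc_of_le ht'.1, uIcc_of_le hT.le]; exact Icc_subset_Icc le_rfl ht.2
    · intro s hs
      have hs' : s ∈ Icc 0 T := ⟨hs.1.le, hs.2.le.trans ht.2⟩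
      refine lt_of_lt_of_le ?_ (h2 s hs')
      rw [h0 s (Ioo_subset_Icc_self hs), mul_zero, sub_zero]
      obtain ⟨hfs, -, -⟩ := aux_finite (hf.conc s hs') (hC s hs').1
      have p1 := aux_ball_pos hK hT hf (half_pos hr) (by linarith) hpos hs'
      have p2 := aux_ball_pos hK hT hf (half_pos hr) (by linarith) hpos' hs'
      rw [integral_pos_iff_support_of_nonneg
        (fun p => mul_nonneg (auxKt_nonneg hK p) (auxTent_nonneg _ _ _))
        (aux_integrable hK (hC s hs').1 (ψ := fun p => auxTent (x + y) r (p.1 + p.2))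
          ((auxTent_cont _ _).comp (by fun_prop)) fun p => auxTent_le hr.le _)]
      have hprod : 0 < ((f s).prod (f s)) (Metric.ball x (r / 2) ×ˢ Metric.ball y (r / 2)) := by
        rw [Measure.prod_prod]
        exact ENNReal.mul_pos p1.ne' p2.ne'
      refine hprod.trans_le (measure_mono ?_)
      rintro ⟨v, w⟩ ⟨hv, hw⟩
      simp only [Metric.mem_ball, Real.dist_eq, abs_lt] at hv hw
      have hv0 : 0 < v := by linarith [hv.1]
      have hvw : v < w := by linarith [hv.2, hw.1]
      have hmem : (v, w) ∈ Ioi (0:ℝ) ×ˢ Ioi (0:ℝ) := ⟨hv0, hv0.trans hvw⟩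
      rw [Function.mem_support]
      refine mul_ne_zero ?_ ?_
      · rw [auxKt, indicator_of_mem hmem]
        exact (auxK_pos hK hv0 hvw).ne'
      · have : v + w ∈ Function.support (auxTent (x + y) r) := by
          rw [auxTent_support, Metric.mem_ball, Real.dist_eq, abs_lt]
          constructor <;> linarith [hv.1, hv.2, hw.1, hw.2]
        exact this
  have h3 := h1 t ht'
  have h4 := h1 0 ⟨le_rfl, hT.le⟩
  rw [intervalIntegral.integral_same, h0 0 ⟨le_rfl, ht'.1⟩] at h4
  linarith

end aux

/-- Under the hypotheses of the induction basis, for every `n ∈ ℕ`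
the solution charges the smaller balls `B(x₁, η₀/2ⁿ)` (for `t ∈ [0,T]`) and
`B(x₁+x₂, η₀/2ⁿ)` (for `t ∈ (0,T]`) by positive constants. -/
theorem small_balls_charged
    (K h : ℝ → ℝ → ℝ) (g : ℝ → ℝ) (γ H H₀ H₁ G₀ G₁ k : ℝ)
    (hK : KernelAssumptionA K h g γ H H₀ H₁ G₀ G₁ k)
    (T : ℝ) (hT : 0 < T)
    (fin : Measure ℝ) (hconc : fin (Iic 0) = 0)
    (hγmom : Integrable (fun v => 1 + v ^ γ) fin)
    (f : ℝ → Measure ℝ) (hf : IsWeakSolution K γ T f fin)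
    (hmc : IsMassConserving T f fin)
    (x₁ x₂ η₀ : ℝ) (hx₁ : 0 < x₁) (hx₁₂ : x₁ < x₂)
    (hη₀ : η₀ ∈ Ioo 0 (min 1 x₁)) (hsep : 3 * η₀ ≤ x₂ - x₁)
    (hAB : ∀ η : ℝ, 0 < η → η ≤ η₀ →
      0 < fin (Metric.ball x₁ η) ∧ 0 < fin (Metric.ball x₂ η)) :
    ∀ n : ℕ,
      (∀ t ∈ Icc (0 : ℝ) T, ∃ C₁ : ℝ, 0 < C₁ ∧
        ENNReal.ofReal C₁ ≤ f t (Metric.ball x₁ (η₀ / 2 ^ n))) ∧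
      (∀ t ∈ Ioc (0 : ℝ) T, ∃ C₂ : ℝ, 0 < C₂ ∧
        ENNReal.ofReal C₂ ≤ f t (Metric.ball (x₁ + x₂) (η₀ / 2 ^ n))) := by
  obtain ⟨hη0, hη1⟩ := hη₀
  have hηx : η₀ < x₁ := hη1.trans_le (min_le_right _ _)
  obtain ⟨hfin, -, -⟩ := aux_finite hconc hγmom
  have conv : ∀ m : ENNReal, 0 < m → ∃ C : ℝ, 0 < C ∧ ENNReal.ofReal C ≤ m := by
    intro m hm
    obtain ⟨q, hq, hqm⟩ := ENNReal.lt_iff_exists_nnreal_btwn.mp hm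
    refine ⟨q, by exact_mod_cast hq, ?_⟩
    rw [ENNReal.ofReal_coe_nnreal]; exact hqm.le
  intro n
  have hr : 0 < η₀ / 2 ^ n := by positivity
  have hrle : η₀ / 2 ^ n ≤ η₀ := div_le_self hη0.le (one_le_pow₀ (by norm_num))
  refine ⟨fun t ht => conv _ ?_, fun t ht => conv _ ?_⟩
  · exact aux_ball_pos hK hT hf hr (by linarith) (hAB _ hr hrle).1 ht
  · have := hAB (η₀ / 2 ^ n / 2) (half_pos hr) (by linarith)
    exact aux_sum_pos hK hT hf hr (by linarith) (by linarith) this.1 this.2 ht
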